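/- Let m ≥ 1 and let W be a polynomial on ℝ^m, not identically zero, such that the degree of W in each individual variable is at most 1. Let f be a nonnegative measurable function on ℝ^m such that f(x) ≤ C(1+|x|²)^{−D} for some constant C and some D > m/2. Then for every ε with 0 < ε < 1, ∫_{ℝ^m} |W(x)|^{−ε} f(x) dx < ∞. -/

import Mathlib

open MeasureTheory

open scoped ENNReal

lemma setLIntegral_ball_enorm_rpow_neg_lt_top {ε : ℝ} (hε1 : ε < 1) :
    ∫⁻ t in Metric.ball (0 : ℝ) 1, ‖t‖ₑ ^ (-ε) < ∞ := by
  have hint : IntegrableOn (fun t : ℝ => |t| ^ (-ε)) (Metric.ball 0 1) := by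
    refine integrableOn_ball_of_norm_le_rpow (C := 1) (α := ε) (by simp) (by simpa using hε1)
      (Filter.Eventually.of_forall fun t => ?_)
      (measurable_norm.pow_const (-ε)).aestronglyMeasurable
    rw [Real.norm_eq_abs, abs_of_nonneg (by positivity), one_mul, Real.norm_eq_abs]
  have hne : ∀ᵐ t : ℝ ∂volume.restrict (Metric.ball (0 : ℝ) 1), t ≠ 0 :=
    ae_restrict_of_ae (volume.ae_ne 0)
  refine lt_of_le_of_lt (lintegral_mono_ae ?_) hint.lintegral_lt_top
  filter_upwards [hne] with t ht
  rw [← ENNReal.ofReal_rpow_of_pos (abs_pos.2 ht), ← Real.norm_eq_abs, ofReal_norm]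

/-- The integral of a negative power of an affine function against a bounded integrable weight is
controlled by the same power of the leading coefficient. -/
lemma exists_lintegral_enorm_affine_rpow_neg_le {ε : ℝ} (hε0 : 0 < ε) (hε1 : ε < 1)
    {w : ℝ → ℝ≥0∞} (hw1 : ∀ t, w t ≤ 1) (hwint : ∫⁻ t, w t < ∞) :
    ∃ K : ℝ≥0∞, K < ∞ ∧ ∀ a b : ℝ,
      ∫⁻ t, ‖a * t + b‖ₑ ^ (-ε) * w t ≤ K * ‖a‖ₑ ^ (-ε) := by
  set J : ℝ≥0∞ := ∫⁻ t in Metric.ball (0 : ℝ) 1, ‖t‖ₑ ^ (-ε)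
  have hJ : J < ∞ := setLIntegral_ball_enorm_rpow_neg_lt_top hε1
  refine ⟨J + (∫⁻ t, w t) + 1, by simp [hJ, hwint], fun a b => ?_⟩
  rcases eq_or_ne a 0 with rfl | ha
  · simp [ENNReal.zero_rpow_of_neg (neg_lt_zero.2 hε0)]
  have hfactor : ∀ t, ‖a * t + b‖ₑ ^ (-ε) * w t
      = ‖a‖ₑ ^ (-ε) * (‖t + b / a‖ₑ ^ (-ε) * w t) := fun t => by
    rw [← mul_assoc, ← ENNReal.mul_rpow_of_ne_top (by simp) (by simp), ← enorm_mul]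
    congr 3
    field_simp
  have hpt : ∀ t, ‖t + b / a‖ₑ ^ (-ε) * w t
      ≤ (Metric.ball (0 : ℝ) 1).indicator (fun u => ‖u‖ₑ ^ (-ε)) (t + b / a) + w t := fun t => by
    by_cases h : t + b / a ∈ Metric.ball (0 : ℝ) 1
    · rw [Set.indicator_of_mem h]
      exact (mul_le_of_le_one_right' (hw1 t)).trans le_self_add
    · rw [Set.indicator_of_notMem h, zero_add]
      refine mul_le_of_le_one_left' ?_
      rw [ENNReal.rpow_neg, ENNReal.inv_le_one]
      refine ENNReal.one_le_rpow ?_ hε0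
      rw [mem_ball_zero_iff, not_lt] at h
      rw [← ofReal_norm]
      simpa using h
  have hmeas : Measurable fun t : ℝ =>
      (Metric.ball (0 : ℝ) 1).indicator (fun u => ‖u‖ₑ ^ (-ε)) (t + b / a) :=
    (Measurable.indicator (by fun_prop) measurableSet_ball).comp (by fun_prop)
  have hne : ‖a‖ₑ ^ (-ε) ≠ ∞ :=
    ENNReal.rpow_ne_top_of_ne_zero (by simpa using ha) (by simp)
  simp_rw [hfactor]
  rw [lintegral_const_mul' _ _ hne, mul_comm]
  gcongr
  refine (lintegral_mono hpt).trans ?_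
  rw [lintegral_add_left hmeas, lintegral_add_right_eq_self
    (fun t => (Metric.ball (0 : ℝ) 1).indicator (fun u => ‖u‖ₑ ^ (-ε)) t),
    lintegral_indicator measurableSet_ball]
  exact le_self_add

lemma MvPolynomial.eval_cons_of_degreeOf_zero_le_one {R : Type*} [CommSemiring R] {n : ℕ}
    {W : MvPolynomial (Fin (n + 1)) R} (hdeg : W.degreeOf 0 ≤ 1) (t : R) (s : Fin n → R) :
    eval (Fin.cons t s : Fin (n + 1) → R) W
      = eval s ((finSuccEquiv R n W).coeff 1) * t + eval s ((finSuccEquiv R n W).coeff 0) := by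
  rw [eval_eq_eval_mv_eval', Polynomial.eq_X_add_C_of_natDegree_le_one
    (p := finSuccEquiv R n W) (by rwa [natDegree_finSuccEquiv])]
  simp

lemma lintegral_fin_succ_eq {n : ℕ} {F : (Fin (n + 1) → ℝ) → ℝ≥0∞} (hF : Measurable F) :
    ∫⁻ x, F x = ∫⁻ s : Fin n → ℝ, ∫⁻ t : ℝ, F (Fin.cons t s) := by
  have hp := (volume_preserving_piFinSuccAbove (fun _ : Fin (n + 1) => ℝ) 0).symm
  rw [← hp.lintegral_comp hF, Measure.volume_eq_prod,
    lintegral_prod_symm' (fun z => F _) (hF.comp (MeasurableEquiv.measurable _))]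
  simp [MeasurableEquiv.piFinSuccAbove, Fin.consEquiv]

lemma lintegral_enorm_eval_rpow_neg_mul_prod_lt_top {ε : ℝ} (hε0 : 0 < ε) (hε1 : ε < 1)
    {w : ℝ → ℝ≥0∞} (hw : Measurable w) (hw1 : ∀ t, w t ≤ 1) (hwint : ∫⁻ t, w t < ∞) {n : ℕ}
    (W : MvPolynomial (Fin n) ℝ) (hW : W ≠ 0) (hdeg : ∀ i, W.degreeOf i ≤ 1) :
    ∫⁻ x : Fin n → ℝ, ‖MvPolynomial.eval x W‖ₑ ^ (-ε) * ∏ i, w (x i) < ∞ := by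
  induction n with
  | zero =>
    have hne : ∀ x, MvPolynomial.eval x W ≠ 0 := fun x h => hW <| by
      rw [MvPolynomial.eq_C_of_isEmpty W] at h ⊢
      simpa using h
    rw [lintegral_unique]
    refine ENNReal.mul_lt_top ?_ (by simp [volume_pi])
    rw [Fin.prod_univ_zero, mul_one]
    exact (ENNReal.rpow_ne_top_of_ne_zero (enorm_ne_zero.2 (hne _)) enorm_ne_top).lt_top
  | succ n ih =>
    set A := (MvPolynomial.finSuccEquiv ℝ n W).coeff 1 with hA_def
    set B := (MvPolynomial.finSuccEquiv ℝ n W).coeff 0 with hB_def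
    have hcoeff : ∀ k j, ((MvPolynomial.finSuccEquiv ℝ n W).coeff k).degreeOf j ≤ 1 := fun k j =>
      (MvPolynomial.degreeOf_coeff_finSuccEquiv W j k).trans (hdeg _)
    have hmeas : ∀ {k : ℕ} (V : MvPolynomial (Fin k) ℝ), Measurable fun x : Fin k → ℝ =>
        ‖MvPolynomial.eval x V‖ₑ ^ (-ε) * ∏ i, w (x i) := fun V => by
      have hV := (MvPolynomial.continuous_eval V).measurable
      fun_prop
    rw [lintegral_fin_succ_eq (hmeas W)]
    simp_rw [MvPolynomial.eval_cons_of_degreeOf_zero_le_one (hdeg 0), Fin.prod_univ_succ,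
      Fin.cons_zero, Fin.cons_succ, ← hA_def, ← hB_def, ← mul_assoc]
    by_cases hA : A = 0
    · have hB : B ≠ 0 := fun hB => hW <| by
        apply (MvPolynomial.finSuccEquiv ℝ n).injective
        rw [Polynomial.eq_X_add_C_of_natDegree_le_one (p := MvPolynomial.finSuccEquiv ℝ n W)
          (by rw [MvPolynomial.natDegree_finSuccEquiv]; exact hdeg 0), ← hA_def, ← hB_def, hA, hB]
        simp
      have hinner : ∀ s : Fin n → ℝ,
          ∫⁻ t, ‖MvPolynomial.eval s A * t + MvPolynomial.eval s B‖ₑ ^ (-ε) * w t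
              * ∏ i, w (s i)
            = (∫⁻ t, w t) * (‖MvPolynomial.eval s B‖ₑ ^ (-ε) * ∏ i, w (s i)) := fun s => by
        rw [← lintegral_mul_const _ hw]
        refine lintegral_congr fun t => ?_
        simp only [hA, map_zero, zero_mul, zero_add]
        ring
      simp_rw [hinner]
      rw [lintegral_const_mul _ (hmeas B)]
      exact ENNReal.mul_lt_top hwint (ih B hB (hcoeff 0))
    · obtain ⟨K, hK, hKle⟩ := exists_lintegral_enorm_affine_rpow_neg_le hε0 hε1 hw1 hwint
      have hinner : ∀ s : Fin n → ℝ,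
          ∫⁻ t, ‖MvPolynomial.eval s A * t + MvPolynomial.eval s B‖ₑ ^ (-ε) * w t
              * ∏ i, w (s i)
            ≤ K * (‖MvPolynomial.eval s A‖ₑ ^ (-ε) * ∏ i, w (s i)) := fun s => by
        rw [lintegral_mul_const _ (by fun_prop), ← mul_assoc]
        gcongr
        exact hKle _ _
      refine (lintegral_mono hinner).trans_lt ?_
      rw [lintegral_const_mul _ (hmeas A)]
      exact ENNReal.mul_lt_top hK (ih A hA (hcoeff 1))

lemma one_add_sum_sq_rpow_neg_le_prod {ι : Type*} [Fintype ι] [Nonempty ι] {D : ℝ} (hD : 0 ≤ D)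
    (x : ι → ℝ) :
    (1 + ∑ i, x i ^ 2) ^ (-D) ≤ ∏ i, (1 + x i ^ 2) ^ (-(D / Fintype.card ι)) := by
  have hcard : (Fintype.card ι : ℝ) ≠ 0 := by simp
  have hsum : (0 : ℝ) < 1 + ∑ i, x i ^ 2 := by positivity
  calc (1 + ∑ i, x i ^ 2) ^ (-D)
      = ∏ _i : ι, (1 + ∑ j, x j ^ 2) ^ (-(D / Fintype.card ι)) := by
        rw [Finset.prod_const, Finset.card_univ, ← Real.rpow_natCast, ← Real.rpow_mul hsum.le]
        congr 1
        field_simp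
    _ ≤ ∏ i, (1 + x i ^ 2) ^ (-(D / Fintype.card ι)) := by
        refine Finset.prod_le_prod (fun i _ => by positivity) fun i _ => ?_
        refine Real.rpow_le_rpow_of_nonpos (by positivity) ?_
          (neg_nonpos.2 (by positivity))
        gcongr
        exact Finset.single_le_sum (f := fun j => x j ^ 2) (fun j _ => sq_nonneg _)
          (Finset.mem_univ i)

/-- Theorem 6.1, second part: if `W` is a nonzero polynomial on `ℝ^m` of degree at
most 1 in each individual variable and `f` is a nonnegative function bounded by
`C(1+|x|²)^{-D}` with `D > m/2`, then `∫ |W(x)|^{-ε} f(x) dx < ∞` for every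
`ε < 1`. -/
theorem integrability_negative_power_of_polynomial_deg_one
    {m : ℕ} (hm : 1 ≤ m)
    (W : MvPolynomial (Fin m) ℝ) (hW : W ≠ 0)
    (hdeg : ∀ i : Fin m, W.degreeOf i ≤ 1)
    (f : (Fin m → ℝ) → ℝ) (hfmeas : Measurable f) (hfnonneg : ∀ x, 0 ≤ f x)
    (C D : ℝ) (hC : 0 ≤ C) (hD : (m : ℝ) / 2 < D)
    (hbound : ∀ x : Fin m → ℝ, f x ≤ C * (1 + ∑ i, x i ^ 2) ^ (-D)) :
    ∀ ε : ℝ, 0 < ε → ε < 1 →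
      Integrable (fun x : Fin m → ℝ => |MvPolynomial.eval x W| ^ (-ε) * f x)
        (volume : Measure (Fin m → ℝ)) := by
  intro ε hε0 hε1
  have : Nonempty (Fin m) := ⟨⟨0, hm⟩⟩
  have hm0 : (0 : ℝ) < m := by exact_mod_cast hm
  have hs : 1 / 2 < D / m := by rw [lt_div_iff₀ hm0]; linarith
  have hD0 : 0 ≤ D := by linarith
  set w : ℝ → ℝ≥0∞ := fun t => ENNReal.ofReal ((1 + t ^ 2) ^ (-(D / m))) with hw_def
  have hw : Measurable w := by fun_prop
  have hw1 : ∀ t, w t ≤ 1 := fun t => ENNReal.ofReal_le_one.2 <|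
    Real.rpow_le_one_of_one_le_of_nonpos (by nlinarith) (by linarith)
  have hwint : ∫⁻ t, w t < ∞ := by
    have h := integrable_rpow_neg_one_add_norm_sq (E := ℝ) (μ := volume) (r := 2 * (D / m))
      (by simp only [Module.finrank_self, Nat.cast_one]; linarith)
    convert h.lintegral_lt_top using 4 with t
    rw [Real.norm_eq_abs, sq_abs]
    congr 1
    ring
  have hmain := lintegral_enorm_eval_rpow_neg_mul_prod_lt_top hε0 hε1 hw hw1 hwint W hW hdeg
  have hWmeas := (MvPolynomial.continuous_eval W).measurable
  refine ⟨by fun_prop, ?_⟩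
  rw [hasFiniteIntegral_iff_enorm]
  refine lt_of_le_of_lt (lintegral_mono fun x => ?_)
    ((lintegral_const_mul' (ENNReal.ofReal C) _ ENNReal.ofReal_ne_top).trans_lt
      (ENNReal.mul_lt_top ENNReal.ofReal_lt_top hmain))
  have hf : ‖f x‖ₑ ≤ ENNReal.ofReal C * ∏ i, w (x i) := by
    rw [Real.enorm_of_nonneg (hfnonneg x), hw_def,
      ← ENNReal.ofReal_prod_of_nonneg (fun i _ => by positivity), ← ENNReal.ofReal_mul hC]
    refine ENNReal.ofReal_le_ofReal ((hbound x).trans ?_)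
    gcongr
    simpa using one_add_sum_sq_rpow_neg_le_prod hD0 x
  have hpow : ‖|MvPolynomial.eval x W| ^ (-ε)‖ₑ ≤ ‖MvPolynomial.eval x W‖ₑ ^ (-ε) := by
    rcases eq_or_ne (MvPolynomial.eval x W) 0 with h | h
    · simp [h, ENNReal.zero_rpow_of_neg (neg_lt_zero.2 hε0)]
    · rw [Real.enorm_of_nonneg (by positivity), ← ENNReal.ofReal_rpow_of_pos (abs_pos.2 h),
        ← Real.norm_eq_abs, ofReal_norm]
  rw [enorm_mul, mul_left_comm]
  exact mul_le_mul' hpow hf
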